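/- arXiv:2005.00010 — 2 statements merged into one kernel-verified Lean document; each statement's English description precedes it below -/
import Mathlib

section
/- In the tracing-attack setup, for every i ∈ {1,...,n}: the expectation of Z'_i (over μ, X, X'_i, and M) is 0; the variance of Z'_i is at most 4α²; and |Z'_i| ≤ 4d almost surely. -/
open MeasureTheory ProbabilityTheory
open scoped NNReal ENNReal

/-- The real value of a random sign (`true ↦ +1`, `false ↦ −1`). -/
def signB (b : Bool) : ℝ := if b then 1 else -1

/-- The distribution on `{−1,+1}` (encoded as `Bool`) with mean `p`:
`+1` with probability `(1+p)/2` and `−1` with probability `(1−p)/2`. -/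
noncomputable def bernSign (p : ℝ) : Measure Bool :=
  (((1 + p) / 2).toNNReal : ℝ≥0) • Measure.dirac true
    + (((1 - p) / 2).toNNReal : ℝ≥0) • Measure.dirac false

instance (p : ℝ) : IsFiniteMeasure (bernSign p) := by
  unfold bernSign; infer_instance

/-- The product distribution `P_μ` on `{−1,+1}^d` with mean vector `μ`. -/
noncomputable def Pprod {d : ℕ} (μ : Fin d → ℝ) : Measure (Fin d → Bool) :=
  Measure.pi fun j => bernSign (μ j)

instance {d : ℕ} (μ : Fin d → ℝ) : IsFiniteMeasure (Pprod μ) := by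
  unfold Pprod; infer_instance

/-- The uniform distribution on `[-1,1] ⊆ ℝ`. -/
noncomputable def uniformIcc : Measure ℝ :=
  ((2 : ℝ≥0))⁻¹ • (volume.restrict (Set.Icc (-1 : ℝ) 1))

instance : IsProbabilityMeasure uniformIcc := by
  constructor
  simp [uniformIcc, Measure.restrict_apply, Real.volume_Icc]
  norm_num
  simp [ENNReal.smul_def, ENNReal.coe_inv, ENNReal.inv_mul_cancel]

/-- The uniform distribution on the cube `[-1,1]^d`. -/
noncomputable def uniformCube (d : ℕ) : Measure (Fin d → ℝ) :=
  Measure.pi fun _ => uniformIcc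

noncomputable def qw (p : ℝ) (b : Bool) : ℝ := (bernSign p).real {b}

lemma qw_true (p : ℝ) (h : p ∈ Set.Icc (-1 : ℝ) 1) : qw p true = (1 + p) / 2 := by
  have : 0 ≤ (1 + p) / 2 := by linarith [h.1]
  simp [qw, bernSign, Measure.real, this]

lemma qw_false (p : ℝ) (h : p ∈ Set.Icc (-1 : ℝ) 1) : qw p false = (1 - p) / 2 := by
  have : 0 ≤ (1 - p) / 2 := by linarith [h.2]
  simp [qw, bernSign, Measure.real, this]

lemma qw_meas (b : Bool) : Measurable fun p => qw p b := by
  cases b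
  · have : (fun p => qw p false) = fun p : ℝ => (((1 - p) / 2).toNNReal : ℝ) := by
      ext p; simp [qw, bernSign, Measure.real]
    rw [this]; fun_prop
  · have : (fun p => qw p true) = fun p : ℝ => (((1 + p) / 2).toNNReal : ℝ) := by
      ext p; simp [qw, bernSign, Measure.real]
    rw [this]; fun_prop

lemma qw_nonneg (p : ℝ) (b : Bool) : 0 ≤ qw p b := measureReal_nonneg

noncomputable def pw {d : ℕ} (μ : Fin d → ℝ) (x : Fin d → Bool) : ℝ := ∏ j, qw (μ j) (x j)

lemma pw_eq {d : ℕ} (μ : Fin d → ℝ) (x : Fin d → Bool) : (Pprod μ).real {x} = pw μ x := by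
  simp [Pprod, pw, qw, Measure.real, Measure.pi_singleton, ENNReal.toReal_prod]

lemma pw_nonneg {d : ℕ} (μ : Fin d → ℝ) (x : Fin d → Bool) : 0 ≤ pw μ x :=
  Finset.prod_nonneg fun _ _ => qw_nonneg _ _

noncomputable def ww {n d : ℕ} (μ : Fin d → ℝ) (X : Fin n → Fin d → Bool) : ℝ := ∏ k, pw μ (X k)

lemma ww_eq {n d : ℕ} (μ : Fin d → ℝ) (X : Fin n → Fin d → Bool) :
    (Measure.pi fun _ : Fin n => Pprod μ).real {X} = ww μ X := by
  simp only [ww, ← pw_eq]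
  simp [Measure.real, Measure.pi_singleton, ENNReal.toReal_prod]

lemma ww_nonneg {n d : ℕ} (μ : Fin d → ℝ) (X : Fin n → Fin d → Bool) : 0 ≤ ww μ X :=
  Finset.prod_nonneg fun _ _ => pw_nonneg _ _

lemma int_P {d : ℕ} (μ : Fin d → ℝ) (f : (Fin d → Bool) → ℝ) :
    ∫ x, f x ∂(Pprod μ) = ∑ x, pw μ x * f x := by
  rw [integral_fintype (Integrable.of_finite)]
  simp [pw_eq]

lemma int_W {n d : ℕ} (μ : Fin d → ℝ) (f : (Fin n → Fin d → Bool) → ℝ) :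
    ∫ X, f X ∂(Measure.pi fun _ : Fin n => Pprod μ) = ∑ X, ww μ X * f X := by
  rw [integral_fintype (Integrable.of_finite)]
  simp only [ww_eq, smul_eq_mul]

lemma sum_prod {d : ℕ} (f : Fin d → Bool → ℝ) :
    ∑ x : Fin d → Bool, ∏ l, f l (x l) = ∏ l, ∑ b, f l b :=
  (Fintype.prod_sum f).symm

lemma sum_pw {d : ℕ} (μ : Fin d → ℝ) (hμ : ∀ j, μ j ∈ Set.Icc (-1 : ℝ) 1) :
    ∑ x, pw μ x = 1 := by
  simp only [pw]
  rw [sum_prod (fun l b => qw (μ l) b)]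
  apply Finset.prod_eq_one
  intro l _
  simp [qw_true _ (hμ l), qw_false _ (hμ l)]
  ring

lemma sum_ww {n d : ℕ} (μ : Fin d → ℝ) (hμ : ∀ j, μ j ∈ Set.Icc (-1 : ℝ) 1) :
    ∑ X : Fin n → Fin d → Bool, ww μ X = 1 := by
  simp only [ww]
  rw [← Fintype.prod_sum (fun (_ : Fin n) x => pw μ x)]
  simp [sum_pw μ hμ]

lemma mean_zero {d : ℕ} (μ : Fin d → ℝ) (hμ : ∀ j, μ j ∈ Set.Icc (-1 : ℝ) 1) (j : Fin d) :
    ∑ x, pw μ x * (signB (x j) - μ j) = 0 := by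
  have h : ∀ x : Fin d → Bool, pw μ x * (signB (x j) - μ j)
      = ∏ l, (qw (μ l) (x l) * (if l = j then signB (x l) - μ l else 1)) := by
    intro x
    rw [Finset.prod_mul_distrib, Finset.prod_ite_eq' Finset.univ j]
    simp [pw]
  simp only [h]
  rw [sum_prod (fun l b => qw (μ l) b * (if l = j then signB b - μ l else 1))]
  apply Finset.prod_eq_zero (Finset.mem_univ j)
  simp [qw_true _ (hμ j), qw_false _ (hμ j), signB]
  ring

lemma cov_zero {d : ℕ} (μ : Fin d → ℝ) (hμ : ∀ j, μ j ∈ Set.Icc (-1 : ℝ) 1) (j k : Fin d)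
    (hjk : j ≠ k) :
    ∑ x, pw μ x * ((signB (x j) - μ j) * (signB (x k) - μ k)) = 0 := by
  have h : ∀ x : Fin d → Bool, pw μ x * ((signB (x j) - μ j) * (signB (x k) - μ k))
      = ∏ l, (qw (μ l) (x l) * ((if l = j then signB (x l) - μ l else 1)
          * (if l = k then signB (x l) - μ l else 1))) := by
    intro x
    rw [Finset.prod_mul_distrib, Finset.prod_mul_distrib, Finset.prod_ite_eq' Finset.univ j,
      Finset.prod_ite_eq' Finset.univ k]
    simp [pw]
  simp only [h]
  rw [sum_prod (fun l b => qw (μ l) b * ((if l = j then signB b - μ l else 1)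
          * (if l = k then signB b - μ l else 1)))]
  apply Finset.prod_eq_zero (Finset.mem_univ j)
  simp [qw_true _ (hμ j), qw_false _ (hμ j), signB, hjk]
  ring

lemma abs_sign_le {p : ℝ} (h : p ∈ Set.Icc (-1 : ℝ) 1) (b : Bool) : |signB b - p| ≤ 2 := by
  obtain ⟨h1, h2⟩ := h
  rw [abs_le]
  cases b <;> simp [signB] <;> constructor <;> linarith

lemma var_le {d : ℕ} (μ : Fin d → ℝ) (hμ : ∀ j, μ j ∈ Set.Icc (-1 : ℝ) 1) (j : Fin d) :
    ∑ x, pw μ x * ((signB (x j) - μ j) * (signB (x j) - μ j)) ≤ 4 := by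
  calc _ ≤ ∑ x, pw μ x * 4 := by
        apply Finset.sum_le_sum
        intro x _
        apply mul_le_mul_of_nonneg_left _ (pw_nonneg _ _)
        have := abs_le.1 (abs_sign_le (hμ j) (x j))
        nlinarith [this.1, this.2]
    _ = 4 := by rw [← Finset.sum_mul, sum_pw μ hμ, one_mul]

lemma mean_lin {d : ℕ} (μ a : Fin d → ℝ) (hμ : ∀ j, μ j ∈ Set.Icc (-1 : ℝ) 1) :
    ∑ x, pw μ x * ∑ j, a j * (signB (x j) - μ j) = 0 := by
  simp only [Finset.mul_sum]
  rw [Finset.sum_comm]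
  apply Finset.sum_eq_zero
  intro j _
  have := mean_zero μ hμ j
  calc _ = a j * ∑ x, pw μ x * (signB (x j) - μ j) := by
        rw [Finset.mul_sum]; exact Finset.sum_congr rfl fun _ _ => by ring
    _ = 0 := by rw [this, mul_zero]

lemma second_lin {d : ℕ} (μ a : Fin d → ℝ) (hμ : ∀ j, μ j ∈ Set.Icc (-1 : ℝ) 1) :
    ∑ x, pw μ x * (∑ j, a j * (signB (x j) - μ j)) ^ 2 ≤ 4 * ∑ j, a j ^ 2 := by
  have e : ∑ x, pw μ x * (∑ j, a j * (signB (x j) - μ j)) ^ 2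
      = ∑ j, ∑ k, a j * a k * ∑ x, pw μ x * ((signB (x j) - μ j) * (signB (x k) - μ k)) := by
    simp only [sq, Finset.sum_mul_sum]
    simp only [Finset.mul_sum]
    rw [Finset.sum_comm]
    apply Finset.sum_congr rfl; intro j _
    rw [Finset.sum_comm]
    apply Finset.sum_congr rfl; intro k _
    apply Finset.sum_congr rfl; intro x _
    ring
  rw [e, Finset.mul_sum]
  apply Finset.sum_le_sum
  intro j _
  rw [Finset.sum_eq_single j]
  · have := var_le μ hμ j
    nlinarith [mul_self_nonneg (a j)]
  · intro k _ hk
    rw [cov_zero μ hμ j k hk.symm, mul_zero]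
  · simp

lemma swap_sum {n d : ℕ} (μ : Fin d → ℝ) (i : Fin n)
    (g : (Fin n → Fin d → Bool) → (Fin d → Bool) → ℝ) :
    ∑ X, ww μ X * ∑ x', pw μ x' * g (Function.update X i x') (X i)
      = ∑ X, ww μ X * ∑ x, pw μ x * g X x := by
  simp only [Finset.mul_sum]
  rw [← Fintype.sum_prod_type', ← Fintype.sum_prod_type']
  let s : (Fin n → Fin d → Bool) × (Fin d → Bool) → (Fin n → Fin d → Bool) × (Fin d → Bool) :=
    fun z => (Function.update z.1 i z.2, z.1 i)
  have hs : Function.Involutive s := by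
    rintro ⟨X, x⟩
    simp [s]
  apply Fintype.sum_equiv hs.toPerm
  rintro ⟨X, x⟩
  simp only [Function.Involutive.coe_toPerm, s, ← mul_assoc]
  congr 1
  simp only [ww]
  rw [← Finset.mul_prod_erase Finset.univ _ (Finset.mem_univ i),
    ← Finset.mul_prod_erase Finset.univ (fun k => pw μ (Function.update X i x k)) (Finset.mem_univ i)]
  have : ∏ k ∈ Finset.univ.erase i, pw μ (Function.update X i x k)
      = ∏ k ∈ Finset.univ.erase i, pw μ (X k) := by
    apply Finset.prod_congr rfl
    intro k hk
    rw [Function.update_of_ne (Finset.ne_of_mem_erase hk)]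
  rw [this]
  simp
  ring

lemma integ_cont {d : ℕ} (ν : Measure (Fin d → Set.Icc (-1 : ℝ) 1)) [IsProbabilityMeasure ν]
    (f : (Fin d → Set.Icc (-1 : ℝ) 1) → ℝ) (hf : Continuous f) : Integrable f ν := by
  obtain ⟨C, hC⟩ := (isCompact_univ (X := Fin d → Set.Icc (-1 : ℝ) 1)).exists_bound_of_continuousOn
    hf.continuousOn
  exact Integrable.of_bound hf.aestronglyMeasurable C (Filter.Eventually.of_forall fun x => hC x trivial)

lemma ae_cube (d : ℕ) : ∀ᵐ μ ∂(uniformCube d), ∀ j, μ j ∈ Set.Icc (-1 : ℝ) 1 := by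
  rw [ae_all_iff]
  intro j
  have h : ∀ᵐ p ∂uniformIcc, p ∈ Set.Icc (-1 : ℝ) 1 := by
    unfold uniformIcc
    exact Measure.ae_smul_measure (ae_restrict_mem measurableSet_Icc) _
  exact (Measure.tendsto_eval_ae_ae (μ := fun _ : Fin d => uniformIcc) (i := j)).eventually h

instance (d : ℕ) : IsProbabilityMeasure (uniformCube d) := by
  unfold uniformCube; infer_instance

lemma ww_meas {n d : ℕ} (X : Fin n → Fin d → Bool) : Measurable fun μ : Fin d → ℝ => ww μ X := by
  unfold ww pw
  refine Finset.measurable_prod _ fun k _ => Finset.measurable_prod _ fun j _ => ?_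
  exact (qw_meas (X k j)).comp (measurable_pi_apply j)

lemma inner_eq {d : ℕ} (ν : Measure (Fin d → Set.Icc (-1 : ℝ) 1)) [IsProbabilityMeasure ν]
    (μ : Fin d → ℝ) : ∫ y, ∑ j, ((y j : ℝ) - μ j) ^ 2 ∂ν
      = ∑ j, ((∫ y, (y j : ℝ) ^ 2 ∂ν) - 2 * μ j * (∫ y, (y j : ℝ) ∂ν) + μ j ^ 2) := by
  rw [integral_finsetSum _ fun j _ => integ_cont ν _ (by fun_prop)]
  apply Finset.sum_congr rfl
  intro j _
  have : ∀ y : Fin d → Set.Icc (-1 : ℝ) 1, ((y j : ℝ) - μ j) ^ 2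
    = (y j : ℝ) ^ 2 - 2 * μ j * (y j : ℝ) + μ j ^ 2 := fun y => by ring
  simp only [this]
  rw [integral_add (integ_cont ν _ (by fun_prop)) (integ_cont ν _ (by fun_prop)),
    integral_sub (integ_cont ν _ (by fun_prop)) (integ_cont ν _ (by fun_prop)),
    integral_const_mul]
  simp

lemma abs_diff_le {p : ℝ} (h : p ∈ Set.Icc (-1 : ℝ) 1) (y : Set.Icc (-1 : ℝ) 1) :
    |(y : ℝ) - p| ≤ 2 := by
  obtain ⟨h1, h2⟩ := h
  obtain ⟨y, h3, h4⟩ := y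
  rw [abs_le]
  constructor <;> simp <;> linarith

lemma rhs_integrable {n d : ℕ}
    (M : (Fin n → (Fin d → Bool)) → Measure (Fin d → Set.Icc (-1 : ℝ) 1))
    (hM : ∀ X, IsProbabilityMeasure (M X)) :
    Integrable (fun μ => ∫ X, ∫ y, ∑ j, ((y j : ℝ) - μ j) ^ 2
      ∂(M X) ∂(Measure.pi fun _ : Fin n => Pprod μ)) (uniformCube d) := by
  simp only [int_W]
  refine Integrable.of_bound (C := 4 * d) ?_ ?_
  · apply Measurable.aestronglyMeasurable
    refine Finset.measurable_sum _ fun X _ => (ww_meas X).mul ?_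
    simp only [inner_eq]
    fun_prop
  · filter_upwards [ae_cube d] with μ hμ
    have hb : ∀ y : Fin d → Set.Icc (-1 : ℝ) 1, ∑ j, ((y j : ℝ) - μ j) ^ 2 ≤ 4 * d := by
      intro y
      calc _ ≤ ∑ _j : Fin d, (4 : ℝ) := by
            apply Finset.sum_le_sum
            intro j _
            have := abs_le.1 (abs_diff_le (hμ j) (y j))
            nlinarith [this.1, this.2]
        _ = _ := by simp [mul_comm]
    have h0 : ∀ X : Fin n → Fin d → Bool, 0 ≤ ∫ y, ∑ j, ((y j : ℝ) - μ j) ^ 2 ∂(M X) := fun X =>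
      integral_nonneg fun y => Finset.sum_nonneg fun j _ => sq_nonneg _
    rw [Real.norm_of_nonneg (Finset.sum_nonneg fun X _ => mul_nonneg (ww_nonneg _ _) (h0 X))]
    calc _ ≤ ∑ X : Fin n → Fin d → Bool, ww μ X * (4 * d) := by
          apply Finset.sum_le_sum
          intro X _
          apply mul_le_mul_of_nonneg_left _ (ww_nonneg _ _)
          calc _ ≤ ∫ y, (4 * d : ℝ) ∂(M X) :=
                integral_mono (integ_cont _ _ (by fun_prop)) (integrable_const _) hb
            _ = _ := by simp
      _ = _ := by rw [← Finset.sum_mul, sum_ww μ hμ, one_mul]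

/-- in the tracing-attack setup (`μ` uniform on `[−1,1]^d`,
`X₁,…,Xₙ` i.i.d. from `P_μ`, `X_{∼i}` obtained from `X` by replacing the `i`-th
entry with a fresh sample `x'` from `P_μ`, and
`Z'_i = ⟨M(X_{∼i}) − μ, X_i − μ⟩`): `E[Z'_i] = 0`, `Var[Z'_i] ≤ 4α²`
(equivalently `E[(Z'_i)²] ≤ 4α²` since the mean is zero), and `|Z'_i| ≤ 4d`
almost surely (i.e. whenever `μ ∈ [−1,1]^d`). -/
theorem tracing_Z'_claims (n d : ℕ)
    (M : (Fin n → (Fin d → Bool)) → Measure (Fin d → Set.Icc (-1 : ℝ) 1))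
    (hM : ∀ X, IsProbabilityMeasure (M X))
    (i : Fin n) (α : ℝ)
    (hα : α ^ 2 = ∫ μ, ∫ X, ∫ y, ∑ j, ((y j : ℝ) - μ j) ^ 2
      ∂(M X) ∂(Measure.pi fun _ : Fin n => Pprod μ) ∂(uniformCube d)) :
    ((∫ μ, ∫ X, ∫ x', ∫ y, ∑ j, ((y j : ℝ) - μ j) * (signB (X i j) - μ j)
        ∂(M (Function.update X i x')) ∂(Pprod μ)
        ∂(Measure.pi fun _ : Fin n => Pprod μ) ∂(uniformCube d)) = 0)
    ∧ ((∫ μ, ∫ X, ∫ x', ∫ y,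
          (∑ j, ((y j : ℝ) - μ j) * (signB (X i j) - μ j)) ^ 2
        ∂(M (Function.update X i x')) ∂(Pprod μ)
        ∂(Measure.pi fun _ : Fin n => Pprod μ) ∂(uniformCube d)) ≤ 4 * α ^ 2)
    ∧ (∀ μ : Fin d → ℝ, (∀ j, μ j ∈ Set.Icc (-1 : ℝ) 1) →
        ∀ (X : Fin n → Fin d → Bool) (y : Fin d → Set.Icc (-1 : ℝ) 1),
          |∑ j, ((y j : ℝ) - μ j) * (signB (X i j) - μ j)| ≤ 4 * d) := by
  refine ⟨?_, ?_, ?_⟩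
  · apply integral_eq_zero_of_ae
    filter_upwards [ae_cube d] with μ hμ
    simp only [int_W, int_P]
    rw [swap_sum μ i (fun X x => ∫ y, ∑ j, ((y j : ℝ) - μ j) * (signB (x j) - μ j) ∂(M X))]
    apply Finset.sum_eq_zero
    intro X _
    simp only [← integral_const_mul]
    rw [← integral_finsetSum _ fun x _ => integ_cont (M X) _ (by fun_prop)]
    simp only [mean_lin μ _ hμ]
    simp
  · rw [hα, ← integral_const_mul]
    apply integral_mono_of_nonneg
    · refine Filter.Eventually.of_forall fun μ => ?_
      exact integral_nonneg fun X => integral_nonneg fun x => integral_nonneg fun y => sq_nonneg _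
    · exact (rhs_integrable M hM).const_mul 4
    · filter_upwards [ae_cube d] with μ hμ
      simp only [int_W, int_P]
      rw [swap_sum μ i
        (fun X x => ∫ y, (∑ j, ((y j : ℝ) - μ j) * (signB (x j) - μ j)) ^ 2 ∂(M X)),
        Finset.mul_sum]
      apply Finset.sum_le_sum
      intro X _
      rw [mul_left_comm]
      apply mul_le_mul_of_nonneg_left _ (ww_nonneg _ _)
      simp only [← integral_const_mul]
      rw [← integral_finsetSum _ fun x _ => integ_cont (M X) _ (by fun_prop)]
      exact integral_mono (integ_cont _ _ (by fun_prop)) (integ_cont _ _ (by fun_prop))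
        fun y => second_lin μ _ hμ
  · intro μ hμ X y
    calc _ ≤ ∑ j, |((y j : ℝ) - μ j) * (signB (X i j) - μ j)| := Finset.abs_sum_le_sum_abs _ _
      _ ≤ ∑ _j : Fin d, (4 : ℝ) := by
          apply Finset.sum_le_sum
          intro j _
          rw [abs_mul]
          have := mul_le_mul (abs_diff_le (hμ j) (y j)) (abs_sign_le (hμ j) (X i j))
            (abs_nonneg _) (by norm_num)
          linarith
      _ = _ := by simp [mul_comm]
end

section
/- Fingerprinting Lemma: Let μ be drawn uniformly from [−1,1], and conditioned on μ let X₁,...,Xₙ ∈ {−1,+1} be drawn independently with each X_i taking value +1 with probability (1+μ)/2 and −1 with probability (1−μ)/2. Then for every function f : {−1,+1}^n → [−1,1], E[(f(X) − μ) · Σᵢ₌₁ⁿ (X_i − μ)] ≥ 1/3 − E[(f(X) − μ)²], where the expectations are over μ and X. -/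
open MeasureTheory ProbabilityTheory
open scoped NNReal ENNReal

noncomputable def wFP {n : ℕ} (x : Fin n → Bool) (t : ℝ) : ℝ := ∏ i, (1 + signB (x i) * t) / 2

lemma signB_sq (b : Bool) : signB b * signB b = 1 := by cases b <;> simp [signB]

lemma wFP_deriv {n : ℕ} (x : Fin n → Bool) (t : ℝ) :
    HasDerivAt (fun t => (1 - t ^ 2) * wFP x t)
      (wFP x t * (∑ i, (signB (x i) - t) - 2 * t)) t := by
  have h1 : ∀ i ∈ (Finset.univ : Finset (Fin n)),
      HasDerivAt (fun t => (1 + signB (x i) * t) / 2) (signB (x i) / 2) t := by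
    intro i _
    simpa using (((hasDerivAt_id t).const_mul (signB (x i))).const_add 1).div_const 2
  have h2 := HasDerivAt.fun_finsetProd h1
  have h3 : HasDerivAt (fun t : ℝ => 1 - t ^ 2) (-(2 * t)) t := by
    simpa using ((hasDerivAt_id t).pow 2).const_sub 1
  refine (h3.mul h2).congr_deriv ?_
  simp only [smul_eq_mul]
  have h4 : (1 - t ^ 2) * ∑ i, (∏ j ∈ Finset.univ.erase i, (1 + signB (x j) * t) / 2) * (signB (x i) / 2)
      = wFP x t * ∑ i, (signB (x i) - t) := by
    rw [Finset.mul_sum, Finset.mul_sum]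
    refine Finset.sum_congr rfl fun i hi => ?_
    have : wFP x t = _ := (Finset.prod_erase_mul _ _ hi).symm
    rw [this]
    linear_combination (-(∏ j ∈ Finset.univ.erase i, (1 + signB (x j) * t) / 2)) * t / 2 * signB_sq (x i)
  rw [h4]
  unfold wFP
  ring

lemma wFP_sum {n : ℕ} (t : ℝ) : ∑ x : Fin n → Bool, wFP x t = 1 := by
  unfold wFP
  rw [← Fintype.prod_sum (fun (_ : Fin n) b => (1 + signB b * t) / 2)]
  apply Finset.prod_eq_one
  intro i _
  simp [signB]
  ring

lemma wFP_cont {n : ℕ} (x : Fin n → Bool) : Continuous (wFP x) := by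
  unfold wFP
  fun_prop

lemma wFP_nonneg {n : ℕ} (x : Fin n → Bool) {t : ℝ} (ht : t ∈ Set.Icc (-1 : ℝ) 1) :
    0 ≤ wFP x t := by
  apply Finset.prod_nonneg
  intro i _
  obtain ⟨h1, h2⟩ := ht
  cases x i <;> simp [signB] <;> linarith

lemma integral_pi_FP {n : ℕ} (h : (Fin n → Bool) → ℝ) {t : ℝ} (ht : t ∈ Set.Icc (-1 : ℝ) 1) :
    ∫ X, h X ∂(Measure.pi fun _ : Fin n => bernSign t) = ∑ x, wFP x t * h x := by
  rw [integral_fintype Integrable.of_finite]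
  refine Finset.sum_congr rfl fun x _ => ?_
  rw [smul_eq_mul]
  congr 1
  rw [Measure.real, Measure.pi_singleton, ENNReal.toReal_prod]
  refine Finset.prod_congr rfl fun i _ => ?_
  obtain ⟨h1, h2⟩ := ht
  cases x i
  · simp [bernSign, signB]
    rw [max_eq_left (by linarith)]; ring
  · simp [bernSign, signB]
    linarith

lemma integral_unif_FP (F G : ℝ → ℝ) (h : ∀ t ∈ Set.Icc (-1 : ℝ) 1, F t = G t) :
    ∫ t, F t ∂uniformIcc = (1 / 2) * ∫ t in (-1 : ℝ)..1, G t := by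
  unfold uniformIcc
  rw [integral_smul_nnreal_measure, setIntegral_congr_fun measurableSet_Icc h,
    integral_Icc_eq_integral_Ioc, intervalIntegral.integral_of_le (by norm_num)]
  simp [NNReal.smul_def]

/-- Fingerprinting Lemma: with `μ` uniform on `[−1,1]` and
`X₁,…,Xₙ ∈ {−1,+1}` conditionally i.i.d. with mean `μ`, every
`f : {−1,+1}ⁿ → [−1,1]` satisfies
`E[(f(X) − μ)·Σᵢ (Xᵢ − μ)] ≥ 1/3 − E[(f(X) − μ)²]`. -/
theorem fingerprinting_lemma (n : ℕ) (f : (Fin n → Bool) → ℝ)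
    (hf : ∀ x, f x ∈ Set.Icc (-1 : ℝ) 1) :
    (1 : ℝ) / 3
      - ∫ μ, ∫ X, (f X - μ) ^ 2 ∂(Measure.pi fun _ : Fin n => bernSign μ) ∂uniformIcc
    ≤ ∫ μ, ∫ X, (f X - μ) * ∑ i, (signB (X i) - μ)
        ∂(Measure.pi fun _ : Fin n => bernSign μ) ∂uniformIcc := by
  have c := fun x : Fin n → Bool => wFP_cont x
  rw [integral_unif_FP _ _ fun t ht => integral_pi_FP (fun X => (f X - t) ^ 2) ht,
    integral_unif_FP _ _ fun t ht => integral_pi_FP (fun X => (f X - t) * ∑ i, (signB (X i) - t)) ht]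
  have key : ∫ t in (-1 : ℝ)..1, ∑ x, f x * (wFP x t * (∑ i, (signB (x i) - t) - 2 * t)) = 0 := by
    rw [intervalIntegral.integral_eq_sub_of_hasDerivAt
      (f := fun t => ∑ x, f x * ((1 - t ^ 2) * wFP x t))
      (fun t _ => HasDerivAt.fun_sum fun x _ => (wFP_deriv x t).const_mul (f x))
      (Continuous.intervalIntegrable (by fun_prop) _ _)]
    simp
  have zero : ∀ t : ℝ, ∑ x : Fin n → Bool, wFP x t * ∑ i, (signB (x i) - t) = 0 := by
    intro t
    have h1 : HasDerivAt (fun t : ℝ => ∑ x : Fin n → Bool, (1 - t ^ 2) * wFP x t) _ t :=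
      HasDerivAt.fun_sum fun x _ => wFP_deriv x t
    simp only [← Finset.mul_sum, wFP_sum, mul_one] at h1
    have h3 : HasDerivAt (fun t : ℝ => 1 - t ^ 2) (-(2 * t)) t := by
      simpa using ((hasDerivAt_id t).pow 2).const_sub 1
    have h4 := h1.unique h3
    simp only [mul_sub (wFP _ t), Finset.sum_sub_distrib, ← Finset.sum_mul, wFP_sum] at h4
    simp only [mul_sub (wFP _ t), Finset.sum_sub_distrib, ← Finset.sum_mul, wFP_sum]
    linarith
  have sq : ∫ t in (-1 : ℝ)..1, t ^ 2 = 2 / 3 := by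
    rw [integral_pow]; norm_num
  have mono : ∫ t in (-1 : ℝ)..1, (t ^ 2 + ∑ x, f x * (wFP x t * (∑ i, (signB (x i) - t) - 2 * t)))
      ≤ ∫ t in (-1 : ℝ)..1, ((∑ x, wFP x t * (f x - t) ^ 2)
        + ∑ x, wFP x t * ((f x - t) * ∑ i, (signB (x i) - t))) := by
    apply intervalIntegral.integral_mono_on (by norm_num)
      (Continuous.intervalIntegrable (by fun_prop) _ _)
      (Continuous.intervalIntegrable (by fun_prop) _ _)
    intro t ht
    have h5 : 0 ≤ ∑ x, wFP x t * f x ^ 2 :=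
      Finset.sum_nonneg fun x _ => mul_nonneg (wFP_nonneg x ht) (sq_nonneg _)
    have h6 : (∑ x, wFP x t * (f x - t) ^ 2)
        + ∑ x, wFP x t * ((f x - t) * ∑ i, (signB (x i) - t))
        = ∑ x, wFP x t * f x ^ 2 + t ^ 2 * ∑ x : Fin n → Bool, wFP x t
          + ∑ x, f x * (wFP x t * (∑ i, (signB (x i) - t) - 2 * t))
          - t * ∑ x : Fin n → Bool, wFP x t * ∑ i, (signB (x i) - t) := by
      rw [Finset.mul_sum, Finset.mul_sum, ← Finset.sum_add_distrib, ← Finset.sum_add_distrib,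
        ← Finset.sum_add_distrib, ← Finset.sum_sub_distrib]
      refine Finset.sum_congr rfl fun x _ => ?_
      ring
    rw [h6, zero, wFP_sum]
    linarith
  rw [intervalIntegral.integral_add (Continuous.intervalIntegrable (by fun_prop) _ _)
      (Continuous.intervalIntegrable (by fun_prop) _ _),
    intervalIntegral.integral_add (Continuous.intervalIntegrable (by fun_prop) _ _)
      (Continuous.intervalIntegrable (by fun_prop) _ _), key, sq] at mono
  linarith
end
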